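/- There is no regulated function f : [0,1] → ℝ such that { x ∈ [0,1] : lim_{n→∞} B_n(f, x) exists and equals f(x) } = ℚ ∩ [0,1]. -/

import Mathlib

open Filter Set

/-- The n-th Bernstein polynomial of `f` evaluated at `x`. -/
noncomputable def bern (f : ℝ → ℝ) (n : ℕ) (x : ℝ) : ℝ :=
  ∑ k ∈ Finset.range (n + 1),
    f ((k : ℝ) / (n : ℝ)) * (n.choose k : ℝ) * x ^ k * (1 - x) ^ (n - k)

/-- `f : [0,1] → ℝ` is regulated. -/
def Regulated (f : ℝ → ℝ) : Prop :=
  (∀ x ∈ Set.Ico (0:ℝ) 1, ∃ L : ℝ, Filter.Tendsto f (nhdsWithin x (Set.Ioc x 1)) (nhds L)) ∧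
  (∀ x ∈ Set.Ioc (0:ℝ) 1, ∃ L : ℝ, Filter.Tendsto f (nhdsWithin x (Set.Ico 0 x)) (nhds L))

namespace Regulated

/-- Near each point of `[0,1]`, a regulated function is nearly constant on either side. -/
theorem exists_near_const {f : ℝ → ℝ} (hf : Regulated f) {x : ℝ} (hx : x ∈ Icc (0 : ℝ) 1)
    {ε : ℝ} (hε : 0 < ε) :
    ∃ δ > 0, ∃ L R : ℝ, ∀ y ∈ Icc (0 : ℝ) 1, |y - x| < δ →
      (y < x → |f y - L| < ε) ∧ (x < y → |f y - R| < ε) := by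
  have hR : ∃ R : ℝ, Tendsto f (nhdsWithin x (Ioc x 1)) (nhds R) := by
    rcases hx.2.lt_or_eq with h | rfl
    · exact hf.1 x ⟨hx.1, h⟩
    · exact ⟨0, by simp⟩
  have hL : ∃ L : ℝ, Tendsto f (nhdsWithin x (Ico 0 x)) (nhds L) := by
    rcases hx.1.lt_or_eq with h | rfl
    · exact hf.2 x ⟨h, hx.2⟩
    · exact ⟨0, by simp⟩
  obtain ⟨R, hR⟩ := hR
  obtain ⟨L, hL⟩ := hL
  obtain ⟨δ₁, h₁, hR⟩ := Metric.tendsto_nhdsWithin_nhds.1 hR ε hε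
  obtain ⟨δ₂, h₂, hL⟩ := Metric.tendsto_nhdsWithin_nhds.1 hL ε hε
  refine ⟨min δ₁ δ₂, lt_min h₁ h₂, L, R, fun y hy hyx => ⟨fun h => ?_, fun h => ?_⟩⟩
  · exact hL ⟨hy.1, h⟩ (hyx.trans_le (min_le_right _ _))
  · exact hR ⟨h, hy.2⟩ (hyx.trans_le (min_le_left _ _))

theorem exists_abs_le {f : ℝ → ℝ} (hf : Regulated f) :
    ∃ M, ∀ y ∈ Icc (0 : ℝ) 1, |f y| ≤ M := by
  refine isCompact_Icc.induction_on (p := fun s => ∃ M, ∀ y ∈ s, |f y| ≤ M) ⟨0, by simp⟩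
    (fun s t hst ⟨M, hM⟩ => ⟨M, fun y hy => hM y (hst hy)⟩) ?_ fun x hx => ?_
  · rintro s t ⟨M, hM⟩ ⟨N, hN⟩
    refine ⟨max M N, ?_⟩
    rintro y (hy | hy)
    · exact (hM y hy).trans (le_max_left _ _)
    · exact (hN y hy).trans (le_max_right _ _)
  · obtain ⟨δ, hδ, L, R, h⟩ := hf.exists_near_const hx one_pos
    refine ⟨Icc 0 1 ∩ Metric.ball x δ, inter_mem_nhdsWithin _ (Metric.ball_mem_nhds x hδ),
      |f x| + |L| + |R| + 1, ?_⟩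
    rintro y ⟨hy, hyx⟩
    obtain ⟨hl, hr⟩ := h y hy hyx
    have := abs_nonneg (f x)
    have := abs_nonneg L
    have := abs_nonneg R
    rcases lt_trichotomy y x with hlt | rfl | hgt
    · linarith [hl hlt, abs_sub_abs_le_abs_sub (f y) L]
    · linarith
    · linarith [hr hgt, abs_sub_abs_le_abs_sub (f y) R]

/-- The points of `[0,1]` where a regulated function oscillates by at least `ε` are countable. -/
theorem countable_oscillation {f : ℝ → ℝ} (hf : Regulated f) {ε : ℝ} (hε : 0 < ε) :
    {z ∈ Icc (0 : ℝ) 1 | ¬ ∃ δ > 0, ∀ y ∈ Icc (0 : ℝ) 1, |y - z| < δ →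
      |f y - f z| < ε}.Countable := by
  let D := {z ∈ Icc (0 : ℝ) 1 | ¬ ∃ δ > 0, ∀ y ∈ Icc (0 : ℝ) 1, |y - z| < δ → |f y - f z| < ε}
  suffices h : (D ∩ Icc 0 1).Countable from
    h.mono fun z (hz : z ∈ D) => mem_inter hz hz.1
  refine isCompact_Icc.induction_on (p := fun s => (D ∩ s).Countable) (by simp)
    (fun s t hst h => h.mono (inter_subset_inter_right _ hst))
    (fun s t hs ht => by rw [inter_union_distrib_left]; exact hs.union ht) fun x hx => ?_
  obtain ⟨δ, hδ, L, R, h⟩ := hf.exists_near_const hx (half_pos hε)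
  refine ⟨Icc 0 1 ∩ Metric.ball x δ, inter_mem_nhdsWithin _ (Metric.ball_mem_nhds x hδ),
    (countable_singleton x).mono ?_⟩
  rintro z ⟨⟨-, hzD⟩, hz, hzx⟩
  by_contra hne
  refine hzD ⟨min (δ - |z - x|) |z - x|,
    lt_min (sub_pos.2 hzx) (abs_pos.2 (sub_ne_zero.2 hne)), fun y hy hyz => ?_⟩
  obtain ⟨h₁, h₂⟩ := lt_min_iff.1 hyz
  have hyx : |y - x| < δ := by linarith [abs_sub_le y z x]
  obtain ⟨hyl, hyr⟩ := h y hy hyx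
  obtain ⟨hzl, hzr⟩ := h z hz hzx
  rcases lt_or_gt_of_ne hne with hlt | hgt
  · rw [abs_of_neg (sub_neg.2 hlt)] at h₂
    have hy' : y < x := by linarith [le_abs_self (y - z)]
    have := abs_sub_le (f y) L (f z)
    linarith [hyl hy', hzl hlt, abs_sub_comm L (f z)]
  · rw [abs_of_pos (sub_pos.2 hgt)] at h₂
    have hy' : x < y := by linarith [neg_abs_le (y - z)]
    have := abs_sub_le (f y) R (f z)
    linarith [hyr hy', hzr hgt, abs_sub_comm R (f z)]

/-- A regulated function has at most countably many discontinuities in `[0,1]`. -/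
theorem countable_not_continuousWithinAt {f : ℝ → ℝ} (hf : Regulated f) :
    {z ∈ Icc (0 : ℝ) 1 | ¬ ContinuousWithinAt f (Icc 0 1) z}.Countable := by
  refine (countable_iUnion fun n : ℕ =>
    hf.countable_oscillation (Nat.one_div_pos_of_nat (α := ℝ) (n := n))).mono ?_
  rintro z ⟨hz, hc⟩
  by_contra hcon
  refine hc (Metric.continuousWithinAt_iff.2 fun ε hε => ?_)
  obtain ⟨n, hn⟩ := exists_nat_one_div_lt hε
  obtain ⟨δ, hδ, h⟩ := not_not.1 fun hosc => hcon (mem_iUnion.2 ⟨n, hz, hosc⟩)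
  exact ⟨δ, hδ, fun {y} hy hyz => (h y hy hyz).trans hn⟩

end Regulated

theorem bern_eq_sum_bernstein (f : ℝ → ℝ) (n : ℕ) (x : unitInterval) :
    bern f n x = ∑ k : Fin (n + 1), f (bernstein.z k) * bernstein n k x := by
  simp only [bern, bernstein_apply, bernstein.z, Finset.sum_range, mul_assoc]

/-- The Bernstein polynomials of a bounded function converge at its points of continuity. -/
theorem tendsto_bern_of_continuousWithinAt {f : ℝ → ℝ} {M : ℝ}
    (hM : ∀ y ∈ Icc (0 : ℝ) 1, |f y| ≤ M) {x : ℝ} (hx : x ∈ Icc (0 : ℝ) 1)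
    (hc : ContinuousWithinAt f (Icc 0 1) x) :
    Tendsto (fun n => bern f n x) atTop (nhds (f x)) := by
  refine Metric.tendsto_nhds.2 fun ε hε => ?_
  obtain ⟨δ, hδ, h⟩ := Metric.continuousWithinAt_iff.1 hc (ε / 2) (half_pos hε)
  have hM0 : 0 ≤ M := (abs_nonneg _).trans (hM x hx)
  have hbound : ∀ y ∈ Icc (0 : ℝ) 1, |f y - f x| ≤ ε / 2 + 2 * M / δ ^ 2 * (x - y) ^ 2 := by
    intro y hy
    rcases lt_or_ge (dist y x) δ with hlt | hge
    · have := h hy hlt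
      rw [Real.dist_eq] at this
      have : 0 ≤ 2 * M / δ ^ 2 * (x - y) ^ 2 := by positivity
      linarith
    · have h₁ : |f y - f x| ≤ 2 * M := by linarith [abs_sub (f y) (f x), hM y hy, hM x hx]
      have h₂ : δ ^ 2 ≤ (x - y) ^ 2 := by
        rw [Real.dist_eq, abs_sub_comm] at hge
        rw [← sq_abs (x - y)]
        gcongr
      have h₃ : 2 * M ≤ 2 * M / δ ^ 2 * (x - y) ^ 2 := by
        rw [div_mul_eq_mul_div, le_div_iff₀ (by positivity)]
        gcongr
      linarith
  have hlim := tendsto_const_div_atTop_nhds_zero_nat (2 * M / δ ^ 2)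
  filter_upwards [hlim.eventually_lt_const (half_pos hε), eventually_ne_atTop 0] with n hn hn0
  have hdiff : bern f n x - f x =
      ∑ k : Fin (n + 1), (f (bernstein.z k) - f x) * bernstein n k ⟨x, hx⟩ := by
    rw [bern_eq_sum_bernstein f n ⟨x, hx⟩]
    simp only [sub_mul, Finset.sum_sub_distrib, ← Finset.mul_sum, bernstein.probability, mul_one]
  rw [Real.dist_eq, hdiff]
  calc |∑ k : Fin (n + 1), (f (bernstein.z k) - f x) * bernstein n k ⟨x, hx⟩|
      ≤ ∑ k : Fin (n + 1), |(f (bernstein.z k) - f x) * bernstein n k ⟨x, hx⟩| :=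
        Finset.abs_sum_le_sum_abs _ _
    _ ≤ ∑ k : Fin (n + 1), (ε / 2 + 2 * M / δ ^ 2 * (x - bernstein.z k) ^ 2) *
          bernstein n k ⟨x, hx⟩ := by
        refine Finset.sum_le_sum fun k _ => ?_
        rw [abs_mul, abs_of_nonneg (bernstein_nonneg (n := n) (ν := k) (x := ⟨x, hx⟩))]
        exact mul_le_mul_of_nonneg_right (hbound _ (bernstein.z k).2) bernstein_nonneg
    _ = ε / 2 + 2 * M / δ ^ 2 * (x * (1 - x) / n) := by
        rw [← bernstein.variance hn0 ⟨x, hx⟩]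
        simp only [add_mul, Finset.sum_add_distrib, mul_assoc, ← Finset.mul_sum,
          bernstein.probability, mul_one]
    _ ≤ ε / 2 + 2 * M / δ ^ 2 * (1 / n) := by
        gcongr
        nlinarith [hx.1, hx.2]
    _ < ε := by
        rw [mul_one_div]
        linarith

theorem stmt7 :
    ¬ ∃ f : ℝ → ℝ, Regulated f ∧
      {x ∈ Set.Icc (0:ℝ) 1 | Filter.Tendsto (fun n => bern f n x) Filter.atTop (nhds (f x))}
        = Set.range ((↑) : ℚ → ℝ) ∩ Set.Icc 0 1 := by
  rintro ⟨f, hf, heq⟩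
  obtain ⟨M, hM⟩ := hf.exists_abs_le
  refine (not_le.2 one_pos : ¬ (1 : ℝ) ≤ 0) (Cardinal.Real.Icc_countable_iff.1
    ((hf.countable_not_continuousWithinAt.union (countable_range ((↑) : ℚ → ℝ))).mono ?_))
  intro x hx
  by_cases hc : ContinuousWithinAt f (Icc 0 1) x
  · exact Or.inr (heq.subset ⟨hx, tendsto_bern_of_continuousWithinAt hM hx hc⟩).1
  · exact Or.inl ⟨hx, hc⟩
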